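/- Let f : ℝ^d → ℝ be differentiable, bounded below by f_*, with γ-Hölder gradient of constant M (γ ∈ (0,1]). Consider SGD iterates w^{k+1} = w^k − η G_k where G_k is a random vector with E[G_k | F_k] = ∇f(w^k) and E[‖G_k‖^{1+γ} | F_k] ≤ σ^{1+γ} almost surely, η > 0, and F_k the filtration generated by w^0,...,w^k. Then min_{0 ≤ k ≤ K−1} E‖∇f(w^k)‖² ≤ (f(w^0) − f_*)/(Kη) + (M/(1+γ)) η^γ σ^{1+γ}. -/

import Mathlib

open MeasureTheory

lemma aux_descent {d : ℕ} (f : EuclideanSpace ℝ (Fin d) → ℝ) (hf : Differentiable ℝ f)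
    (γ M : ℝ) (hγ0 : 0 < γ)
    (hHolder : ∀ x y : EuclideanSpace ℝ (Fin d),
      ‖gradient f x - gradient f y‖ ≤ M * ‖x - y‖ ^ γ)
    (x v : EuclideanSpace ℝ (Fin d)) :
    f (x + v) ≤ f x + inner ℝ (gradient f x) v + M / (1 + γ) * ‖v‖ ^ (1 + γ) := by
  let φ : ℝ → ℝ := fun t => f (x + t • v) - t * inner ℝ (gradient f x) v
    - M / (1 + γ) * ‖v‖ ^ (1 + γ) * t ^ (1 + γ)
  have hd : ∀ t : ℝ, HasDerivAt φ (inner ℝ (gradient f (x + t • v)) v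
      - inner ℝ (gradient f x) v - M * ‖v‖ ^ (1 + γ) * t ^ γ) t := by
    intro t
    have h1 : HasDerivAt (fun t : ℝ => x + t • v) v t := by
      simpa using ((hasDerivAt_id t).smul_const v).const_add x
    have h2 := ((hf (x + t • v)).hasGradientAt.hasFDerivAt).comp_hasDerivAt t h1
    have h3 : HasDerivAt (fun t : ℝ => t * inner ℝ (gradient f x) v)
        (inner ℝ (gradient f x) v) t := by
      simpa using (hasDerivAt_id t).mul_const (inner ℝ (gradient f x) v)
    have h4 : HasDerivAt (fun t : ℝ => t ^ (1 + γ)) ((1 + γ) * t ^ (1 + γ - 1)) t :=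
      Real.hasDerivAt_rpow_const (Or.inr (by linarith))
    have h5 := (h2.sub h3).sub (h4.const_mul (M / (1 + γ) * ‖v‖ ^ (1 + γ)))
    refine h5.congr_deriv ?_
    have : (1 + γ) ≠ 0 := by linarith
    rw [add_sub_cancel_left, InnerProductSpace.toDual_apply_apply]
    field_simp
  have hanti : AntitoneOn φ (Set.Icc 0 1) := by
    apply antitoneOn_of_deriv_nonpos (convex_Icc 0 1)
    · exact fun t _ => (hd t).continuousAt.continuousWithinAt
    · exact fun t _ => (hd t).differentiableAt.differentiableWithinAt
    · intro t ht
      rw [interior_Icc] at ht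
      rw [(hd t).deriv, ← inner_sub_left]
      have h1 := real_inner_le_norm (gradient f (x + t • v) - gradient f x) v
      have h2 := hHolder (x + t • v) x
      rw [add_sub_cancel_left, norm_smul, Real.norm_of_nonneg ht.1.le,
        Real.mul_rpow ht.1.le (norm_nonneg _)] at h2
      have h3 := mul_le_mul_of_nonneg_right h2 (norm_nonneg v)
      have h4 : ‖v‖ ^ (1 + γ) = ‖v‖ * ‖v‖ ^ γ := by
        rw [Real.rpow_add' (norm_nonneg _) (by linarith), Real.rpow_one]
      rw [h4]
      nlinarith
  have := hanti (Set.left_mem_Icc.2 zero_le_one) (Set.right_mem_Icc.2 zero_le_one) zero_le_one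
  simp only [φ, one_smul, zero_smul, Real.one_rpow, add_zero] at this
  rw [Real.zero_rpow (by linarith)] at this
  linarith

lemma aux_cont {d : ℕ} (g : EuclideanSpace ℝ (Fin d) → EuclideanSpace ℝ (Fin d))
    (γ M : ℝ) (hγ0 : 0 < γ)
    (hHolder : ∀ x y : EuclideanSpace ℝ (Fin d), ‖g x - g y‖ ≤ M * ‖x - y‖ ^ γ) :
    Continuous g := by
  rw [continuous_iff_continuousAt]
  intro y
  rw [ContinuousAt, tendsto_iff_norm_sub_tendsto_zero]
  refine squeeze_zero (fun _ => norm_nonneg _) (fun x => hHolder x y) ?_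
  have : ContinuousAt (fun x => M * ‖x - y‖ ^ γ) y := by
    apply Continuous.continuousAt
    exact continuous_const.mul ((continuous_id.sub continuous_const).norm.rpow_const
      (fun _ => Or.inr hγ0.le))
  simpa [ContinuousAt, Real.zero_rpow hγ0.ne'] using this

theorem stmt_3 (d K : ℕ) (hd : 0 < d) (hK : 0 < K)
    {Ω : Type*} [m0 : MeasurableSpace Ω] (μ : Measure Ω) [IsProbabilityMeasure μ]
    (ℱ : ℕ → MeasurableSpace Ω) (hℱ : ∀ k, ℱ k ≤ m0)
    (f : EuclideanSpace ℝ (Fin d) → ℝ) (hf : Differentiable ℝ f)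
    (fstar : ℝ) (hfbdd : ∀ x, fstar ≤ f x)
    (γ M σ η : ℝ) (hγ0 : 0 < γ) (hγ1 : γ ≤ 1) (hM : 0 < M) (hσ : 0 < σ) (hη : 0 < η)
    (hHolder : ∀ x y : EuclideanSpace ℝ (Fin d),
      ‖gradient f x - gradient f y‖ ≤ M * ‖x - y‖ ^ γ)
    (w G : ℕ → Ω → EuclideanSpace ℝ (Fin d))
    (w0 : EuclideanSpace ℝ (Fin d)) (hw0 : w 0 = fun _ => w0)
    (hiter : ∀ k, w (k + 1) = fun ω => w k ω - η • G k ω)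
    (hadapted : ∀ k, StronglyMeasurable[ℱ k] (w k))
    (hGint : ∀ k, Integrable (G k) μ)
    (hGmoment_int : ∀ k, Integrable (fun ω => ‖G k ω‖ ^ (1 + γ)) μ)
    (hunbiased : ∀ k, μ[G k | ℱ k] =ᵐ[μ] fun ω => gradient f (w k ω))
    (hmoment : ∀ k, ∀ᵐ ω ∂μ,
      (μ[fun ω' => ‖G k ω'‖ ^ (1 + γ) | ℱ k]) ω ≤ σ ^ (1 + γ)) :
    (Finset.range K).inf' (Finset.nonempty_range_iff.mpr hK.ne')
        (fun k => ∫ ω, ‖gradient f (w k ω)‖ ^ 2 ∂μ)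
      ≤ (f w0 - fstar) / ((K : ℝ) * η) + (M / (1 + γ)) * η ^ γ * σ ^ (1 + γ) := by
  have hp : (1:ℝ) ≤ 1 + γ := by linarith
  have hgc : Continuous (gradient f) := aux_cont _ γ M hγ0 hHolder
  have hsm : ∀ k, StronglyMeasurable[ℱ k] (fun ω => gradient f (w k ω)) := fun k =>
    hgc.comp_stronglyMeasurable (hadapted k)
  have hb : ∀ k, ∀ᵐ ω ∂μ, ‖gradient f (w k ω)‖ ≤ σ := by
    intro k
    filter_upwards [_root_.Integrable.norm_condExp_rpow_le hp (hGmoment_int k) (m := ℱ k), hunbiased k,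
      hmoment k] with ω h1 h2 h3
    rw [h2] at h1
    exact (Real.rpow_le_rpow_iff (norm_nonneg _) hσ.le (by linarith)).1 (h1.trans h3)
  have hsq : ∀ k, Integrable (fun ω => ‖gradient f (w k ω)‖ ^ 2) μ := by
    intro k
    refine Integrable.of_bound (((hsm k).mono (hℱ k)).aestronglyMeasurable.norm.pow 2) (σ ^ 2) ?_
    filter_upwards [hb k] with ω h
    rw [norm_pow, norm_norm]
    gcongr
  have hin : ∀ k, Integrable (fun ω => inner ℝ (gradient f (w k ω)) (G k ω)) μ := by
    intro k
    exact (innerSL ℝ).integrable_of_bilin_of_bdd_left σ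
      ((hsm k).mono (hℱ k)).aestronglyMeasurable (hb k) (hGint k)
  have hinEq : ∀ k, ∫ ω, inner ℝ (gradient f (w k ω)) (G k ω) ∂μ
      = ∫ ω, ‖gradient f (w k ω)‖ ^ 2 ∂μ := by
    intro k
    rw [← integral_condExp (hℱ k)]
    refine integral_congr_ae ?_
    have := condExp_bilin_of_stronglyMeasurable_left (innerSL ℝ) (hsm k) (hin k) (hGint k)
    filter_upwards [this, hunbiased k] with ω h1 h2
    rw [h2] at h1
    refine h1.trans ?_
    rw [innerSL_apply_apply, real_inner_self_eq_norm_sq]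
  have hmom : ∀ k, ∫ ω, ‖G k ω‖ ^ (1 + γ) ∂μ ≤ σ ^ (1 + γ) := by
    intro k
    rw [← integral_condExp (hℱ k)]
    have := integral_mono_ae (μ := μ) integrable_condExp (integrable_const (σ ^ (1 + γ))) (hmoment k)
    simpa using this
  let c : ℝ := M / (1 + γ) * η ^ (1 + γ)
  have hc : 0 ≤ c := by positivity
  have hdesc : ∀ k ω, f (w (k + 1) ω) ≤ f (w k ω) - η * inner ℝ (gradient f (w k ω)) (G k ω)
      + c * ‖G k ω‖ ^ (1 + γ) := by
    intro k ω
    have h := aux_descent f hf γ M hγ0 hHolder (w k ω) (-(η • G k ω))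
    rw [hiter]
    rw [← sub_eq_add_neg, inner_neg_right, inner_smul_right, norm_neg, norm_smul,
      Real.norm_of_nonneg hη.le, Real.mul_rpow hη.le (norm_nonneg _)] at h
    simp only [c]
    linarith
  have hRint : ∀ k, Integrable (fun ω => f (w k ω)) μ → Integrable (fun ω => f (w k ω)
      - η * inner ℝ (gradient f (w k ω)) (G k ω) + c * ‖G k ω‖ ^ (1 + γ)) μ := fun k h =>
    (h.sub ((hin k).const_mul η)).add ((hGmoment_int k).const_mul c)
  have hfint : ∀ k, Integrable (fun ω => f (w k ω)) μ := by
    intro k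
    induction k with
    | zero => simp [hw0]
    | succ k ih =>
      refine integrable_of_le_of_le (g₁ := fun _ => fstar)
        (hf.continuous.comp_stronglyMeasurable
          ((hadapted (k + 1)).mono (hℱ (k + 1)))).aestronglyMeasurable
        (ae_of_all _ fun ω => hfbdd _) (ae_of_all _ fun ω => hdesc k ω)
        (integrable_const _) (hRint k ih)
  have hstep : ∀ k, η * ∫ ω, ‖gradient f (w k ω)‖ ^ 2 ∂μ
      ≤ (∫ ω, f (w k ω) ∂μ) - (∫ ω, f (w (k + 1) ω) ∂μ) + c * σ ^ (1 + γ) := by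
    intro k
    have h := integral_mono (hfint (k + 1)) (hRint k (hfint k)) (hdesc k)
    have hs : Integrable (fun ω => f (w k ω) - η * inner ℝ (gradient f (w k ω)) (G k ω)) μ :=
      (hfint k).sub ((hin k).const_mul η)
    rw [integral_add hs ((hGmoment_int k).const_mul c),
      integral_sub (hfint k) ((hin k).const_mul η), integral_const_mul, integral_const_mul,
      hinEq] at h
    have := mul_le_mul_of_nonneg_left (hmom k) hc
    linarith
  have hsum := Finset.sum_le_sum (s := Finset.range K) (fun k _ => hstep k)
  rw [Finset.sum_add_distrib, Finset.sum_range_sub' (fun k => ∫ ω, f (w k ω) ∂μ),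
    Finset.sum_const, Finset.card_range, nsmul_eq_mul] at hsum
  have h0 : ∫ ω, f (w 0 ω) ∂μ = f w0 := by simp [hw0]
  have hKl : fstar ≤ ∫ ω, f (w K ω) ∂μ := by
    have := integral_mono (integrable_const fstar) (hfint K) (fun ω => hfbdd (w K ω))
    simpa using this
  have hlow : (K : ℝ) * (η * (Finset.range K).inf' (Finset.nonempty_range_iff.mpr hK.ne')
        (fun k => ∫ ω, ‖gradient f (w k ω)‖ ^ 2 ∂μ))
      ≤ ∑ k ∈ Finset.range K, η * ∫ ω, ‖gradient f (w k ω)‖ ^ 2 ∂μ := by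
    have := Finset.card_nsmul_le_sum (Finset.range K)
      (fun k => η * ∫ ω, ‖gradient f (w k ω)‖ ^ 2 ∂μ)
      (η * (Finset.range K).inf' (Finset.nonempty_range_iff.mpr hK.ne')
        (fun k => ∫ ω, ‖gradient f (w k ω)‖ ^ 2 ∂μ))
      (fun k hk => mul_le_mul_of_nonneg_left (Finset.inf'_le _ hk) hη.le)
    simpa using this
  have hKpos : (0 : ℝ) < K := by exact_mod_cast hK
  have hKη : 0 < (K : ℝ) * η := mul_pos hKpos hη
  have hcη : c = η * (M / (1 + γ) * η ^ γ) := by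
    simp only [c]
    rw [Real.rpow_add hη, Real.rpow_one]
    ring
  rw [hcη] at hsum
  rw [← mul_le_mul_iff_right₀ hKη, mul_add, mul_div_cancel₀ _ hKη.ne']
  linarith
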